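/- arXiv:hep-th/0303187 — 2 statements merged into one kernel-verified Lean document; each statement's English description precedes it below -/
import Mathlib

section
/- Let S : ℝ × ℝ → N²×N² complex matrices satisfy unitarity S₁₂(χ₁,χ₂)S₁₂(χ₂,χ₁) = 1 and Hermitian analyticity S₁₂(χ₁,χ₂)† = S₁₂(χ₂,χ₁), and let R⁺, R⁻ : ℝ → M both satisfy (SR): S₁₂(χ₁,χ₂)R^±₂(χ₁) = R^±₁(χ₁)S₁₂(−χ₁,χ₂) for all χ₁,χ₂. Define the doubled exchange matrix 𝒮 over the index set I := {+,−} × {1,…,N} by 𝒮_{(ξ₁,i₁)(ξ₂,i₂)}^{(η₁,j₁)(η₂,j₂)}(χ₁,χ₂) := δ_{ξ₁,η₂}·δ_{ξ₂,η₁}·S_{i₁i₂}^{j₁j₂}(χ₁,χ₂), and the 2N×2N matrix ℛ(χ) := [[R⁺(χ), 0], [0, R⁻(−χ)†]] for χ > 0 and ℛ(χ) := [[R⁺(−χ)†, 0], [0, R⁻(χ)]] for χ < 0. Then the pair (𝒮, ℛ) satisfies condition (cSR): 𝒮₁₂(χ₁,χ₂)ℛ₂(χ₁) = ℛ₁(χ₁)𝒮₁₂(−χ₁,χ₂)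 for all χ₁ ≠ 0 and all χ₂ ≠ 0. (Part of Proposition 4.1.) -/
open Matrix Kronecker

/-- The doubled exchange matrix `𝒮` of equation (cS), over the index set
`I = {+,−} × {1,…,N}` realized as `Fin N ⊕ Fin N` (with `inl` the `+` sector):
`𝒮_{(ξ₁,i₁)(ξ₂,i₂)}^{(η₁,j₁)(η₂,j₂)} = δ_{ξ₁,η₂} δ_{ξ₂,η₁} S_{i₁i₂}^{j₁j₂}`. -/
noncomputable def dblS {N : ℕ}
    (S : ℝ → ℝ → Matrix (Fin N × Fin N) (Fin N × Fin N) ℂ) (χ₁ χ₂ : ℝ) :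
    Matrix ((Fin N ⊕ Fin N) × (Fin N ⊕ Fin N)) ((Fin N ⊕ Fin N) × (Fin N ⊕ Fin N)) ℂ :=
  fun a b =>
    (if a.1.isLeft = b.2.isLeft then 1 else 0) *
    (if a.2.isLeft = b.1.isLeft then 1 else 0) *
      S χ₁ χ₂ (Sum.elim id id a.1, Sum.elim id id a.2)
        (Sum.elim id id b.1, Sum.elim id id b.2)

/-- The vacuum reflection matrix `ℛ(χ)` of equation (cR). -/
noncomputable def calR {N : ℕ} (Rp Rm : ℝ → Matrix (Fin N) (Fin N) ℂ) (χ : ℝ) :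
    Matrix (Fin N ⊕ Fin N) (Fin N ⊕ Fin N) ℂ :=
  if 0 < χ then Matrix.fromBlocks (Rp χ) 0 0 ((Rm (-χ))ᴴ)
  else Matrix.fromBlocks ((Rp (-χ))ᴴ) 0 0 (Rm χ)

/-- Block-diagonal matrices satisfy the doubled exchange relation as soon as both blocks
satisfy the undoubled one. -/
theorem dblS_mul_one_kronecker_fromBlocks {N : ℕ}
    (S : ℝ → ℝ → Matrix (Fin N × Fin N) (Fin N × Fin N) ℂ)
    (A D : Matrix (Fin N) (Fin N) ℂ) (χ₁ χ₂ ψ₁ ψ₂ : ℝ)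
    (hA : S χ₁ χ₂ * ((1 : Matrix (Fin N) (Fin N) ℂ) ⊗ₖ A)
      = (A ⊗ₖ (1 : Matrix (Fin N) (Fin N) ℂ)) * S ψ₁ ψ₂)
    (hD : S χ₁ χ₂ * ((1 : Matrix (Fin N) (Fin N) ℂ) ⊗ₖ D)
      = (D ⊗ₖ (1 : Matrix (Fin N) (Fin N) ℂ)) * S ψ₁ ψ₂) :
    dblS S χ₁ χ₂ *
        ((1 : Matrix (Fin N ⊕ Fin N) (Fin N ⊕ Fin N) ℂ) ⊗ₖ Matrix.fromBlocks A 0 0 D)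
      = (Matrix.fromBlocks A 0 0 D ⊗ₖ (1 : Matrix (Fin N ⊕ Fin N) (Fin N ⊕ Fin N) ℂ))
          * dblS S ψ₁ ψ₂ := by
  ext ⟨a₁, a₂⟩ ⟨b₁, b₂⟩
  have hA' := congrFun₂ hA (Sum.elim id id a₁, Sum.elim id id a₂)
    (Sum.elim id id b₁, Sum.elim id id b₂)
  have hD' := congrFun₂ hD (Sum.elim id id a₁, Sum.elim id id a₂)
    (Sum.elim id id b₁, Sum.elim id id b₂)
  simp only [Matrix.mul_apply, Fintype.sum_prod_type, Matrix.kroneckerMap_apply,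
    Matrix.one_apply] at hA' hD' ⊢
  simp only [ite_mul, mul_ite, one_mul, mul_one, zero_mul, mul_zero, Finset.sum_ite_irrel,
    Finset.sum_const_zero, Finset.sum_ite_eq, Finset.sum_ite_eq', Finset.mem_univ,
    if_true] at hA' hD'
  rcases a₁ with a₁ | a₁ <;> rcases a₂ with a₂ | a₂ <;> rcases b₁ with b₁ | b₁ <;>
    rcases b₂ with b₂ | b₂ <;> simp [dblS] <;> assumption

/-- Under unitarity and Hermitian analyticity, the exchange relation passes from `R` at `-χ₁`
to its conjugate transpose at `χ₁`. -/
theorem exchange_conjTranspose {n : Type*} [Fintype n] [DecidableEq n]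
    (S : ℝ → ℝ → Matrix (n × n) (n × n) ℂ) (A : Matrix n n ℂ) (χ₁ χ₂ : ℝ)
    (unit1 : ∀ χ₁ χ₂ : ℝ, S χ₁ χ₂ * S χ₂ χ₁ = 1)
    (herm : ∀ χ₁ χ₂ : ℝ, (S χ₁ χ₂)ᴴ = S χ₂ χ₁)
    (h : S (-χ₁) χ₂ * ((1 : Matrix n n ℂ) ⊗ₖ A) = (A ⊗ₖ (1 : Matrix n n ℂ)) * S χ₁ χ₂) :
    S χ₁ χ₂ * ((1 : Matrix n n ℂ) ⊗ₖ Aᴴ) = (Aᴴ ⊗ₖ (1 : Matrix n n ℂ)) * S (-χ₁) χ₂ := by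
  have h' : ((1 : Matrix n n ℂ) ⊗ₖ Aᴴ) * S χ₂ (-χ₁)
      = S χ₂ χ₁ * (Aᴴ ⊗ₖ (1 : Matrix n n ℂ)) := by
    simpa [Matrix.conjTranspose_mul, Matrix.conjTranspose_kronecker, herm] using
      congrArg Matrix.conjTranspose h
  calc S χ₁ χ₂ * ((1 : Matrix n n ℂ) ⊗ₖ Aᴴ)
      = S χ₁ χ₂ * (((1 : Matrix n n ℂ) ⊗ₖ Aᴴ) * S χ₂ (-χ₁)) * S (-χ₁) χ₂ := by
        simp only [Matrix.mul_assoc, unit1, Matrix.mul_one]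
    _ = (Aᴴ ⊗ₖ (1 : Matrix n n ℂ)) * S (-χ₁) χ₂ := by
        rw [h', ← Matrix.mul_assoc, unit1, Matrix.one_mul]

/-- Part of Proposition 4.1: if `S` is unitary, Hermitian analytic, and `R⁺`, `R⁻`
satisfy condition (SR), then the pair `(𝒮, ℛ)` satisfies condition (cSR). -/
theorem stmt12 (N : ℕ) (hN : 1 ≤ N)
    (S : ℝ → ℝ → Matrix (Fin N × Fin N) (Fin N × Fin N) ℂ)
    (Rp Rm : ℝ → Matrix (Fin N) (Fin N) ℂ)
    (unit1 : ∀ χ₁ χ₂ : ℝ, S χ₁ χ₂ * S χ₂ χ₁ = 1)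
    (herm : ∀ χ₁ χ₂ : ℝ, (S χ₁ χ₂)ᴴ = S χ₂ χ₁)
    (SRp : ∀ χ₁ χ₂ : ℝ,
      S χ₁ χ₂ * ((1 : Matrix (Fin N) (Fin N) ℂ) ⊗ₖ Rp χ₁)
        = (Rp χ₁ ⊗ₖ (1 : Matrix (Fin N) (Fin N) ℂ)) * S (-χ₁) χ₂)
    (SRm : ∀ χ₁ χ₂ : ℝ,
      S χ₁ χ₂ * ((1 : Matrix (Fin N) (Fin N) ℂ) ⊗ₖ Rm χ₁)
        = (Rm χ₁ ⊗ₖ (1 : Matrix (Fin N) (Fin N) ℂ)) * S (-χ₁) χ₂) :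
    ∀ χ₁ χ₂ : ℝ, χ₁ ≠ 0 → χ₂ ≠ 0 →
      dblS S χ₁ χ₂ * ((1 : Matrix (Fin N ⊕ Fin N) (Fin N ⊕ Fin N) ℂ) ⊗ₖ calR Rp Rm χ₁)
        = (calR Rp Rm χ₁ ⊗ₖ (1 : Matrix (Fin N ⊕ Fin N) (Fin N ⊕ Fin N) ℂ))
            * dblS S (-χ₁) χ₂ := by
  intro χ₁ χ₂ _ _
  have hp := exchange_conjTranspose S (Rp (-χ₁)) χ₁ χ₂ unit1 herm
    (by simpa using SRp (-χ₁) χ₂)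
  have hm := exchange_conjTranspose S (Rm (-χ₁)) χ₁ χ₂ unit1 herm
    (by simpa using SRm (-χ₁) χ₂)
  unfold calR
  split_ifs
  · exact dblS_mul_one_kronecker_fromBlocks S _ _ _ _ _ _ (SRp χ₁ χ₂) hm
  · exact dblS_mul_one_kronecker_fromBlocks S _ _ _ _ _ _ hp (SRm χ₁ χ₂)
end

section
/- Fix n ≥ 2 and suppose S₁₂ satisfies (unit1) and the braid-form quantum Yang–Baxter equation, and T, R : ℝ → M satisfy (rr1), (tt1), (tr1), and the unitarity conditions T(χ)T(χ) + R(χ)R(−χ) = 1 and T(χ)R(χ) + R(χ)T(−χ) = 0 for all χ. Then the operators σ₁, …, σ_{n−1}, τ on V_n satisfy: σ_i ∘ σ_i = id for all i; τ ∘ τ = id; σ_i ∘ σ_j = σ_j ∘ σ_i whenever |i − j| ≥ 2; σ_i ∘ τ = τ ∘ σ_i for 1 ≤ i ≤ n−2; σ_i ∘ σ_{i+1} ∘ σ_i = σ_{i+1} ∘ σ_i ∘ σ_{i+1} for 1 ≤ i ≤ n−2; and σ_{n−1} ∘ τ ∘ σ_{n−1} ∘ τ = τ ∘ σ_{n−1}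 ∘ τ ∘ σ_{n−1}. Hence the assignment σ_i ↦ σ_i, τ ↦ τ defines a representation of the Weyl group of type Bₙ on V_n. (Proposition 3.4, relations part.) -/
open Matrix

/-- The space `V_n` of functions `φ : ℝⁿ → ((Fin n → Fin N) → ℂ)`, written
componentwise `φ_{α₁…αₙ}(χ₁,…,χₙ)`. -/
abbrev Vspace (N n : ℕ) := (Fin n → ℝ) → (Fin n → Fin N) → ℂ

/-- `A₁ := A ⊗ 1` acting on `ℂ^N ⊗ ℂ^N`. -/
noncomputable def emb1 {N : ℕ} (A : Matrix (Fin N) (Fin N) ℂ) :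
    Matrix (Fin N × Fin N) (Fin N × Fin N) ℂ :=
  fun p q => A p.1 q.1 * (if p.2 = q.2 then 1 else 0)

/-- `A₂ := 1 ⊗ A` acting on `ℂ^N ⊗ ℂ^N`. -/
noncomputable def emb2 {N : ℕ} (A : Matrix (Fin N) (Fin N) ℂ) :
    Matrix (Fin N × Fin N) (Fin N × Fin N) ℂ :=
  fun p q => (if p.1 = q.1 then 1 else 0) * A p.2 q.2

/-- `M ⊗ 1` acting on the factors 1,2 of the triple tensor product. -/
noncomputable def lift12 {I : Type*} [DecidableEq I]
    (M : Matrix (I × I) (I × I) ℂ) : Matrix (I × I × I) (I × I × I) ℂ :=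
  fun p q => M (p.1, p.2.1) (q.1, q.2.1) * (if p.2.2 = q.2.2 then 1 else 0)

/-- `1 ⊗ M` acting on the factors 2,3 of the triple tensor product. -/
noncomputable def lift23 {I : Type*} [DecidableEq I]
    (M : Matrix (I × I) (I × I) ℂ) : Matrix (I × I × I) (I × I × I) ℂ :=
  fun p q => (if p.1 = q.1 then 1 else 0) * M (p.2.1, p.2.2) (q.2.1, q.2.2)

/-- The operator `σ_i^{(n)}` of equation (sigman), exchanging the `i`-th and
`(i+1)`-th particles (positions `i` and `i+1`, `0`-indexed). -/
noncomputable def sigmaOp {N : ℕ} (n : ℕ)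
    (S : ℝ → ℝ → Matrix (Fin N × Fin N) (Fin N × Fin N) ℂ)
    (i : ℕ) (h : i + 1 < n) : Vspace N n → Vspace N n :=
  fun φ χ α =>
    ∑ β : Fin N × Fin N,
      S (χ ⟨i, Nat.lt_of_succ_lt h⟩) (χ ⟨i + 1, h⟩)
          (α ⟨i, Nat.lt_of_succ_lt h⟩, α ⟨i + 1, h⟩) β *
        φ (χ ∘ Equiv.swap (⟨i, Nat.lt_of_succ_lt h⟩ : Fin n) ⟨i + 1, h⟩)
          (Function.update (Function.update α ⟨i, Nat.lt_of_succ_lt h⟩ β.1) ⟨i + 1, h⟩ β.2)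

/-- The operator `τ^{(n)}` of equation (taun), acting on the last particle. -/
noncomputable def tauOp {N : ℕ} (n : ℕ)
    (T R : ℝ → Matrix (Fin N) (Fin N) ℂ) (h : 0 < n) : Vspace N n → Vspace N n :=
  fun φ χ α =>
    (∑ β : Fin N, T (χ ⟨n - 1, Nat.sub_lt h one_pos⟩) (α ⟨n - 1, Nat.sub_lt h one_pos⟩) β *
        φ χ (Function.update α ⟨n - 1, Nat.sub_lt h one_pos⟩ β)) +
    (∑ β : Fin N, R (χ ⟨n - 1, Nat.sub_lt h one_pos⟩) (α ⟨n - 1, Nat.sub_lt h one_pos⟩) β *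
        φ (Function.update χ ⟨n - 1, Nat.sub_lt h one_pos⟩ (-(χ ⟨n - 1, Nat.sub_lt h one_pos⟩)))
          (Function.update α ⟨n - 1, Nat.sub_lt h one_pos⟩ β))

theorem emb2_mk {N : ℕ} (A : Matrix (Fin N) (Fin N) ℂ) (a b c d : Fin N) :
    emb2 A (a, b) (c, d) = if a = c then A b d else 0 := by
  simp [emb2]

theorem lift12_mk {I : Type*} [DecidableEq I] (M : Matrix (I × I) (I × I) ℂ) (a b c a' b' c' : I) :
    lift12 M (a, b, c) (a', b', c') = if c = c' then M (a, b) (a', b') else 0 := by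
  simp [lift12]

theorem lift23_mk {I : Type*} [DecidableEq I] (M : Matrix (I × I) (I × I) ℂ) (a b c a' b' c' : I) :
    lift23 M (a, b, c) (a', b', c') = if a = a' then M (b, c) (b', c') else 0 := by
  simp [lift23]

/-- A component of type `B` of a state of type `V`, with the well-behaved read and write
operations. -/
structure Component (V B : Type*) where
  /-- Read the component. -/
  get : V → B
  /-- Overwrite the component. -/
  set : B → V → V
  get_set : ∀ b v, get (set b v) = b
  set_get : ∀ v, set (get v) v = v
  set_set : ∀ b b' v, set b (set b' v) = set b v

namespace Component

variable {V B C D : Type*}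

/-- Two components are independent if writing one does not affect the other. -/
structure Indep (l : Component V B) (m : Component V C) : Prop where
  get_set_left : ∀ c v, l.get (m.set c v) = l.get v
  get_set_right : ∀ b v, m.get (l.set b v) = m.get v
  set_comm : ∀ b c v, l.set b (m.set c v) = m.set c (l.set b v)

theorem Indep.symm {l : Component V B} {m : Component V C} (h : l.Indep m) : m.Indep l :=
  ⟨h.get_set_right, h.get_set_left, fun b c v => (h.set_comm c b v).symm⟩

/-- The joint component formed by two independent components. -/
def prod (l : Component V B) (m : Component V C) (h : l.Indep m) : Component V (B × C) where
  get v := (l.get v, m.get v)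
  set b v := m.set b.2 (l.set b.1 v)
  get_set b v := by simp [h.get_set_left, l.get_set, m.get_set]
  set_get v := by
    rw [l.set_get, m.set_get]
  set_set b b' v := by
    rw [h.set_comm, l.set_set, m.set_set]

theorem Indep.prod_right {k : Component V D} {l : Component V B} {m : Component V C}
    (h : l.Indep m) (hl : k.Indep l) (hm : k.Indep m) : k.Indep (l.prod m h) where
  get_set_left c v := by simp [prod, hl.get_set_left, hm.get_set_left]
  get_set_right b v := by simp [prod, hl.get_set_right, hm.get_set_right]
  set_comm b c v := by simp [prod, hl.set_comm, hm.set_comm]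

/-- The action of a matrix on the component `l` of a function of the state. -/
noncomputable def act [Fintype B] (l : Component V B) (A : Matrix B B ℂ) (f : V → ℂ) : V → ℂ :=
  fun v => ∑ b, A (l.get v) b * f (l.set b v)

section act

variable [Fintype B] [Fintype C] [Fintype D]

theorem act_act (l : Component V B) (A A' : Matrix B B ℂ) (f : V → ℂ) :
    l.act A (l.act A' f) = l.act (A * A') f := by
  funext v
  simp only [act, l.get_set, l.set_set, Matrix.mul_apply, Finset.mul_sum, Finset.sum_mul]
  rw [Finset.sum_comm]
  simp only [mul_assoc]

theorem act_one [DecidableEq B] (l : Component V B) (f : V → ℂ) : l.act 1 f = f := by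
  funext v
  simp [act, Matrix.one_apply, l.set_get]

theorem act_add (l : Component V B) (A : Matrix B B ℂ) (f g : V → ℂ) :
    l.act A (f + g) = l.act A f + l.act A g := by
  funext v
  simp [act, mul_add, Finset.sum_add_distrib]

theorem add_act (l : Component V B) (A A' : Matrix B B ℂ) (f : V → ℂ) :
    l.act (A + A') f = l.act A f + l.act A' f := by
  funext v
  simp [act, add_mul, Finset.sum_add_distrib]

theorem zero_act (l : Component V B) (f : V → ℂ) : l.act 0 f = 0 := by
  funext v
  simp [act]

theorem Indep.act_comm {l : Component V B} {m : Component V C} (h : l.Indep m)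
    (A : Matrix B B ℂ) (A' : Matrix C C ℂ) (f : V → ℂ) :
    l.act A (m.act A' f) = m.act A' (l.act A f) := by
  funext v
  simp only [act, h.get_set_left, h.get_set_right, h.set_comm, Finset.mul_sum]
  rw [Finset.sum_comm]
  simp only [mul_left_comm]

theorem act_emb2 {N : ℕ} (l m : Component V (Fin N)) (h : l.Indep m)
    (A : Matrix (Fin N) (Fin N) ℂ) (f : V → ℂ) :
    (l.prod m h).act (emb2 A) f = m.act A f := by
  funext v
  simp [act, prod, emb2_mk, Fintype.sum_prod_type, l.set_get]

theorem act_lift23 [DecidableEq B] (k l m : Component V B) (h : l.Indep m)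
    (h' : k.Indep (l.prod m h)) (A : Matrix (B × B) (B × B) ℂ) (f : V → ℂ) :
    (k.prod (l.prod m h) h').act (lift23 A) f = (l.prod m h).act A f := by
  funext v
  simp [act, prod, lift23_mk, Fintype.sum_prod_type, k.set_get]

theorem act_lift12 [DecidableEq B] (k l m : Component V B) (hkl : k.Indep l) (hkm : k.Indep m)
    (h : l.Indep m) (h' : k.Indep (l.prod m h)) (A : Matrix (B × B) (B × B) ℂ) (f : V → ℂ) :
    (k.prod (l.prod m h) h').act (lift12 A) f = (k.prod l hkl).act A f := by
  funext v
  have key (b c : B) : m.set (m.get v) (l.set c (k.set b v)) = l.set c (k.set b v) := by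
    rw [h.symm.set_comm, hkm.symm.set_comm, m.set_get]
  simp [act, prod, lift12_mk, Fintype.sum_prod_type, key]

end act

variable {ι I : Type*} [DecidableEq ι]

/-- The value at the site `i` of a family indexed by `ι`. -/
def site (i : ι) : Component (ι → I) I where
  get v := v i
  set b v := Function.update v i b
  get_set b v := by simp
  set_get v := by simp
  set_set b b' v := by simp

theorem site_indep {i j : ι} (h : i ≠ j) : (site i : Component (ι → I) I).Indep (site j) where
  get_set_left c v := by simp [site, h]
  get_set_right c v := by simp [site, h.symm]
  set_comm b c v := by simp only [site, Function.update_comm h]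

/-- The values at two distinct sites. -/
def pair (i j : ι) (h : i ≠ j) : Component (ι → I) (I × I) :=
  (site i).prod (site j) (site_indep h)

theorem site_indep_pair {k i j : ι} (h : i ≠ j) (hi : k ≠ i) (hj : k ≠ j) :
    (site k : Component (ι → I) I).Indep (pair i j h) :=
  (site_indep h).prod_right (site_indep hi) (site_indep hj)

theorem pair_indep_pair {i j k l : ι} (h : i ≠ j) (h' : k ≠ l) (hik : i ≠ k) (hil : i ≠ l)
    (hjk : j ≠ k) (hjl : j ≠ l) :
    (pair i j h : Component (ι → I) (I × I)).Indep (pair k l h') :=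
  (site_indep h').prod_right (site_indep_pair h hik.symm hjk.symm).symm
    (site_indep_pair h hil.symm hjl.symm).symm

end Component

section Operators

open Component

variable {ι : Type*} [DecidableEq ι] {N : ℕ}

theorem update_comp_swap (χ : ι → ℝ) (i j k : ι) (x : ℝ) :
    Function.update χ k x ∘ Equiv.swap i j
      = Function.update (χ ∘ Equiv.swap i j) (Equiv.swap i j k) x := by
  simpa using Function.update_comp_equiv χ (Equiv.swap i j) k x

theorem comp_swap_comp_swap (χ : ι → ℝ) (i j : ι) :
    (χ ∘ Equiv.swap i j) ∘ Equiv.swap i j = χ := by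
  funext k
  simp

/-- The exchange operator on the sites `i` and `j`. -/
noncomputable def exchange (S : ℝ → ℝ → Matrix (Fin N × Fin N) (Fin N × Fin N) ℂ)
    (i j : ι) (h : i ≠ j) (φ : (ι → ℝ) → (ι → Fin N) → ℂ) : (ι → ℝ) → (ι → Fin N) → ℂ :=
  fun χ => (pair i j h).act (S (χ i) (χ j)) (φ (χ ∘ Equiv.swap i j))

/-- The reflection-transmission operator at the site `l`. -/
noncomputable def reflection (T R : ℝ → Matrix (Fin N) (Fin N) ℂ)
    (l : ι) (φ : (ι → ℝ) → (ι → Fin N) → ℂ) : (ι → ℝ) → (ι → Fin N) → ℂ :=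
  fun χ => (site l).act (T (χ l)) (φ χ) +
    (site l).act (R (χ l)) (φ (Function.update χ l (-(χ l))))

variable {S : ℝ → ℝ → Matrix (Fin N × Fin N) (Fin N × Fin N) ℂ}
  {T R : ℝ → Matrix (Fin N) (Fin N) ℂ}

theorem exchange_exchange (unit1 : ∀ χ₁ χ₂ : ℝ, S χ₁ χ₂ * S χ₂ χ₁ = 1) (i j : ι) (h : i ≠ j)
    (φ : (ι → ℝ) → (ι → Fin N) → ℂ) : exchange S i j h (exchange S i j h φ) = φ := by
  funext χ
  simp only [exchange, act_act, comp_swap_comp_swap, Function.comp_apply, Equiv.swap_apply_left,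
    Equiv.swap_apply_right, unit1, act_one]

theorem reflection_reflection (unitTR1 : ∀ χ : ℝ, T χ * T χ + R χ * R (-χ) = 1)
    (unitTR0 : ∀ χ : ℝ, T χ * R χ + R χ * T (-χ) = 0) (l : ι)
    (φ : (ι → ℝ) → (ι → Fin N) → ℂ) : reflection T R l (reflection T R l φ) = φ := by
  funext χ
  simp only [reflection, act_add, act_act, Function.update_self, Function.update_idem, neg_neg,
    Function.update_eq_self]
  rw [add_comm ((site l).act (R (χ l) * T (-χ l)) _), add_add_add_comm, ← add_act, ← add_act,
    unitTR1, unitTR0, act_one, zero_act, add_zero]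

theorem exchange_comm (i j k l : ι) (h : i ≠ j) (h' : k ≠ l) (hik : i ≠ k) (hil : i ≠ l)
    (hjk : j ≠ k) (hjl : j ≠ l) (φ : (ι → ℝ) → (ι → Fin N) → ℂ) :
    exchange S i j h (exchange S k l h' φ) = exchange S k l h' (exchange S i j h φ) := by
  funext χ
  have hχ : (χ ∘ Equiv.swap i j) ∘ Equiv.swap k l = (χ ∘ Equiv.swap k l) ∘ Equiv.swap i j := by
    funext m
    simp only [Function.comp_apply, Equiv.swap_apply_def]
    grind
  simp only [exchange, Function.comp_apply, Equiv.swap_apply_of_ne_of_ne, hik, hil, hjk, hjl,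
    hik.symm, hil.symm, hjk.symm, hjl.symm, ne_eq, not_false_eq_true, hχ]
  exact (pair_indep_pair h h' hik hil hjk hjl).act_comm _ _ _

theorem exchange_reflection_comm (i j l : ι) (h : i ≠ j) (hi : l ≠ i) (hj : l ≠ j)
    (φ : (ι → ℝ) → (ι → Fin N) → ℂ) :
    exchange S i j h (reflection T R l φ) = reflection T R l (exchange S i j h φ) := by
  funext χ
  simp only [exchange, reflection, act_add, update_comp_swap, Function.comp_apply,
    Equiv.swap_apply_of_ne_of_ne hi hj, Function.update_of_ne hi.symm, Function.update_of_ne hj.symm,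
    (site_indep_pair h hi hj).act_comm]

theorem exchange_braid
    (qyb : ∀ χ₁ χ₂ χ₃ : ℝ,
      lift12 (S χ₁ χ₂) * lift23 (S χ₁ χ₃) * lift12 (S χ₂ χ₃)
        = lift23 (S χ₂ χ₃) * lift12 (S χ₁ χ₃) * lift23 (S χ₁ χ₂))
    (i j k : ι) (hij : i ≠ j) (hjk : j ≠ k) (hik : i ≠ k) (φ : (ι → ℝ) → (ι → Fin N) → ℂ) :
    exchange S i j hij (exchange S j k hjk (exchange S i j hij φ))
      = exchange S j k hjk (exchange S i j hij (exchange S j k hjk φ)) := by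
  funext χ
  have hχ : ((χ ∘ Equiv.swap i j) ∘ Equiv.swap j k) ∘ Equiv.swap i j
      = ((χ ∘ Equiv.swap j k) ∘ Equiv.swap i j) ∘ Equiv.swap j k := by
    funext m
    simp only [Function.comp_apply, Equiv.swap_apply_def]
    grind
  have h12 (A : Matrix (Fin N × Fin N) (Fin N × Fin N) ℂ) (f : (ι → Fin N) → ℂ) :
      (pair i j hij).act A f
        = ((site i).prod (pair j k hjk) (site_indep_pair hjk hij hik)).act (lift12 A) f :=
    (act_lift12 _ _ _ _ (site_indep hik) _ _ A f).symm
  have h23 (A : Matrix (Fin N × Fin N) (Fin N × Fin N) ℂ) (f : (ι → Fin N) → ℂ) :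
      (pair j k hjk).act A f
        = ((site i).prod (pair j k hjk) (site_indep_pair hjk hij hik)).act (lift23 A) f :=
    (act_lift23 _ _ _ _ _ A f).symm
  simp only [exchange, h12, h23, act_act, hχ, Function.comp_apply, Equiv.swap_apply_left,
    Equiv.swap_apply_right, Equiv.swap_apply_of_ne_of_ne, ne_eq, hij, hik,
    hik.symm, hjk.symm, not_false_eq_true, ← mul_assoc, qyb]

theorem exchange_reflection_braid
    (unit1 : ∀ χ₁ χ₂ : ℝ, S χ₁ χ₂ * S χ₂ χ₁ = 1)
    (rr1 : ∀ χ₁ χ₂ : ℝ,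
      S χ₁ χ₂ * emb2 (R χ₁) * S χ₂ (-χ₁) * emb2 (R χ₂)
        = emb2 (R χ₂) * S χ₁ (-χ₂) * emb2 (R χ₁) * S (-χ₂) (-χ₁))
    (tt1 : ∀ χ₁ χ₂ : ℝ,
      S χ₁ χ₂ * emb2 (T χ₁) * S χ₂ χ₁ * emb2 (T χ₂)
        = emb2 (T χ₂) * S χ₁ χ₂ * emb2 (T χ₁) * S χ₂ χ₁)
    (tr1 : ∀ χ₁ χ₂ : ℝ,
      S χ₁ χ₂ * emb2 (T χ₁) * S χ₂ χ₁ * emb2 (R χ₂)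
        = emb2 (R χ₂) * S χ₁ (-χ₂) * emb2 (T χ₁) * S (-χ₂) χ₁)
    (i j : ι) (h : i ≠ j) (φ : (ι → ℝ) → (ι → Fin N) → ℂ) :
    exchange S i j h (reflection T R j (exchange S i j h (reflection T R j φ)))
      = reflection T R j (exchange S i j h (reflection T R j (exchange S i j h φ))) := by
  have rt1 (x y : ℝ) : S x y * emb2 (R x) * S y (-x) * emb2 (T y)
      = emb2 (T y) * S x y * emb2 (R x) * S y (-x) := by
    calc S x y * emb2 (R x) * S y (-x) * emb2 (T y)
        = S x y * (emb2 (R x) * S y (-x) * emb2 (T y) * S (-x) y) * S y (-x) := by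
          simp only [mul_assoc, unit1, mul_one]
      _ = (S x y * S y x) * emb2 (T y) * S x y * emb2 (R x) * S y (-x) := by
          rw [← tr1]
          simp only [mul_assoc]
      _ = emb2 (T y) * S x y * emb2 (R x) * S y (-x) := by rw [unit1, one_mul]
  funext χ
  have hsite (A : Matrix (Fin N) (Fin N) ℂ) (f : (ι → Fin N) → ℂ) :
      (site j).act A f = (pair i j h).act (emb2 A) f :=
    (act_emb2 _ _ _ A f).symm
  simp only [exchange, reflection, hsite, act_add, act_act, update_comp_swap,
    comp_swap_comp_swap, Function.comp_apply, Equiv.swap_apply_left, Equiv.swap_apply_right,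
    Function.update_self, Function.update_of_ne h, ← mul_assoc,
    rr1, tt1, tr1, rt1, Function.update_comm h]
  abel

end Operators

/-- Proposition 3.4 (relations part): under unitarity, the quantum Yang–Baxter
equation, (rr1), (tt1), (tr1) and the unitarity conditions (unitTR1), (unitTR0),
the operators `σ_i` and `τ` satisfy the defining relations of the Weyl group of
type `Bₙ`, hence define a representation of it on `V_n`. -/
theorem stmt16 (N n : ℕ) (hN : 1 ≤ N) (hn : 2 ≤ n)
    (S : ℝ → ℝ → Matrix (Fin N × Fin N) (Fin N × Fin N) ℂ)
    (T R : ℝ → Matrix (Fin N) (Fin N) ℂ)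
    (unit1 : ∀ χ₁ χ₂ : ℝ, S χ₁ χ₂ * S χ₂ χ₁ = 1)
    (qyb : ∀ χ₁ χ₂ χ₃ : ℝ,
      lift12 (S χ₁ χ₂) * lift23 (S χ₁ χ₃) * lift12 (S χ₂ χ₃)
        = lift23 (S χ₂ χ₃) * lift12 (S χ₁ χ₃) * lift23 (S χ₁ χ₂))
    (rr1 : ∀ χ₁ χ₂ : ℝ,
      S χ₁ χ₂ * emb2 (R χ₁) * S χ₂ (-χ₁) * emb2 (R χ₂)
        = emb2 (R χ₂) * S χ₁ (-χ₂) * emb2 (R χ₁) * S (-χ₂) (-χ₁))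
    (tt1 : ∀ χ₁ χ₂ : ℝ,
      S χ₁ χ₂ * emb2 (T χ₁) * S χ₂ χ₁ * emb2 (T χ₂)
        = emb2 (T χ₂) * S χ₁ χ₂ * emb2 (T χ₁) * S χ₂ χ₁)
    (tr1 : ∀ χ₁ χ₂ : ℝ,
      S χ₁ χ₂ * emb2 (T χ₁) * S χ₂ χ₁ * emb2 (R χ₂)
        = emb2 (R χ₂) * S χ₁ (-χ₂) * emb2 (T χ₁) * S (-χ₂) χ₁)
    (unitTR1 : ∀ χ : ℝ, T χ * T χ + R χ * R (-χ) = 1)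
    (unitTR0 : ∀ χ : ℝ, T χ * R χ + R χ * T (-χ) = 0) :
    (∀ (i : ℕ) (h : i + 1 < n),
      sigmaOp n S i h ∘ sigmaOp n S i h = id) ∧
    (tauOp n T R (by omega) ∘ tauOp n T R (by omega) = id) ∧
    (∀ (i j : ℕ) (hi : i + 1 < n) (hj : j + 1 < n),
      i + 2 ≤ j ∨ j + 2 ≤ i →
      sigmaOp n S i hi ∘ sigmaOp n S j hj = sigmaOp n S j hj ∘ sigmaOp n S i hi) ∧
    (∀ (i : ℕ) (h : i + 2 < n),
      sigmaOp n S i (by omega) ∘ tauOp n T R (by omega)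
        = tauOp n T R (by omega) ∘ sigmaOp n S i (by omega)) ∧
    (∀ (i : ℕ) (h : i + 2 < n),
      sigmaOp n S i (by omega) ∘ sigmaOp n S (i + 1) h ∘ sigmaOp n S i (by omega)
        = sigmaOp n S (i + 1) h ∘ sigmaOp n S i (by omega) ∘ sigmaOp n S (i + 1) h) ∧
    (sigmaOp n S (n - 2) (by omega) ∘ tauOp n T R (by omega)
        ∘ sigmaOp n S (n - 2) (by omega) ∘ tauOp n T R (by omega)
      = tauOp n T R (by omega) ∘ sigmaOp n S (n - 2) (by omega)
        ∘ tauOp n T R (by omega) ∘ sigmaOp n S (n - 2) (by omega)) := by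
  have hne (i : ℕ) (h : i + 1 < n) : (⟨i, Nat.lt_of_succ_lt h⟩ : Fin n) ≠ ⟨i + 1, h⟩ := by
    simp
  have hσ (i : ℕ) (h : i + 1 < n) : sigmaOp n S i h = exchange S _ _ (hne i h) := rfl
  have hτ : tauOp n T R (by omega) = reflection T R ⟨n - 1, by omega⟩ := rfl
  simp only [hσ, hτ]
  refine ⟨fun i h => funext fun φ => exchange_exchange unit1 _ _ _ φ,
    funext fun φ => reflection_reflection unitTR1 unitTR0 _ φ,
    fun i j hi hj hij => funext fun φ => ?_, fun i h => funext fun φ => ?_,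
    fun i h => funext fun φ => ?_, funext fun φ => ?_⟩
  · apply exchange_comm <;> simp only [ne_eq, Fin.mk.injEq] <;> omega
  · apply exchange_reflection_comm <;> simp only [ne_eq, Fin.mk.injEq] <;> omega
  · apply exchange_braid qyb
    simp only [ne_eq, Fin.mk.injEq]
    omega
  · obtain ⟨m, rfl⟩ : ∃ m, n = m + 2 := ⟨n - 2, by omega⟩
    exact exchange_reflection_braid unit1 rr1 tt1 tr1 _ _ _ φ
end
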